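/- Let M ∈ ℕ and let A be a complex (M+1)×(M+1) matrix indexed by {0,1,…,M} that is tridiagonal, i.e. A_{ij} = 0 whenever |i − j| > 1. Suppose v ∈ ℂ^{M+1} and α ∈ ℂ satisfy A v = v + α e_M, where e_M is the standard basis vector supported at the last index M. Then for every k ∈ ℕ and every index i with i + k ≤ M, one has (A^k v)_i = v_i. -/

import Mathlib

open Matrix

/-- light-cone/windowed-moment lemma: if `A` is a tridiagonal
`(M+1)×(M+1)` matrix and `A v = v + α e_M` with `e_M` the standard basis vector
at the last index, then `(A^k v)_i = v_i` for every index `i` with `i + k ≤ M`. -/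
theorem tridiagonal_lightcone {M : ℕ} (A : Matrix (Fin (M + 1)) (Fin (M + 1)) ℂ)
    (hA : ∀ i j : Fin (M + 1), 1 < |(i : ℤ) - (j : ℤ)| → A i j = 0)
    (v : Fin (M + 1) → ℂ) (α : ℂ)
    (hv : A.mulVec v = v + α • (Pi.single (Fin.last M) 1 : Fin (M + 1) → ℂ)) :
    ∀ (k : ℕ) (i : Fin (M + 1)), (i : ℕ) + k ≤ M → (A ^ k).mulVec v i = v i := by
  intro k
  induction k with
  | zero => simp
  | succ k ih =>
    intro i hi
    have hi_ne : i ≠ Fin.last M := fun h => by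
      rw [h, Fin.val_last] at hi
      omega
    have hAv : A.mulVec v i = v i := by
      rw [hv]
      simp [hi_ne]
    rw [pow_succ', ← mulVec_mulVec, ← hAv]
    change ∑ j, A i j * (A ^ k).mulVec v j = ∑ j, A i j * v j
    refine Finset.sum_congr rfl fun j _ => ?_
    by_cases hj : (j : ℕ) + k ≤ M
    · rw [ih j hj]
    · rw [hA i j (by rw [lt_abs]; omega), zero_mul, zero_mul]
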